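/- arXiv:2405.13982 — 3 statements merged into one kernel-verified Lean document; each statement's English description precedes it below -/
import Mathlib

section
/- Let C and D be additive monoidal categories and F : C ⥤ D a monoidal additive functor. Let I be a set of objects of C such that every object of C is isomorphic to a finite direct sum of objects of I, and assume that every object of C has a right dual. If for every X ∈ I the map Hom_C(X, 𝟙_C) → Hom_D(F(X), 𝟙_D) induced by F (composed with the structure isomorphism F(𝟙_C) ≅ 𝟙_D) is injective, then F is a faithful functor. -/
open CategoryTheory CategoryTheory.Limits MonoidalCategory

universe v₁ v₂ u₁ u₂

attribute [local instance] CategoryTheory.Limits.hasBinaryBiproducts_of_finite_biproducts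

/-- If applying an additive functor `F` and postcomposing with `i` is injective on morphisms
`Z j ⟶ A`, then `F` detects vanishing of morphisms to `A` out of the direct sum of the
`Z j`. -/
lemma eq_zero_of_map_comp_eq_zero_of_iso_biproduct
    {C : Type u₁} [Category.{v₁} C] [Preadditive C] [HasFiniteBiproducts C]
    {D : Type u₂} [Category.{v₂} D] [Preadditive D] (F : C ⥤ D) [F.Additive]
    {A : C} {B : D} (i : F.obj A ⟶ B) {n : ℕ} (Z : Fin n → C)
    (hZ : ∀ j, Function.Injective (fun φ : Z j ⟶ A => F.map φ ≫ i))
    {X : C} (e : X ≅ ⨁ Z) (φ : X ⟶ A) (hφ : F.map φ = 0) : φ = 0 := by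
  rw [← cancel_epi e.inv, comp_zero]
  refine biproduct.hom_ext' _ _ fun j => hZ j ?_
  simp [hφ]

/-- A monoidal additive functor which detects vanishing of morphisms to the unit is faithful,
provided every object of the source has a right dual. -/
lemma faithful_of_eq_zero_of_map_eq_zero_to_unit
    {C : Type u₁} [Category.{v₁} C] [MonoidalCategory C] [Preadditive C] [MonoidalPreadditive C]
    {D : Type u₂} [Category.{v₂} D] [MonoidalCategory D] [Preadditive D] [MonoidalPreadditive D]
    [RightRigidCategory C] (F : C ⥤ D) [F.Monoidal] [F.Additive]
    (h : ∀ {X : C} (φ : X ⟶ 𝟙_ C), F.map φ = 0 → φ = 0) : F.Faithful := by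
  refine ⟨fun {X Y} f g hfg => ?_⟩
  rw [← sub_eq_zero, ← cancel_mono (ρ_ Y).inv, zero_comp]
  have hF : F.map (f - g) = 0 := by rw [F.map_sub, hfg, sub_self]
  have key : (f - g) ≫ (ρ_ Y).inv = 0 ↔
      (tensorLeftHomEquiv X Y Yᘁ (𝟙_ C)).symm ((f - g) ≫ (ρ_ Y).inv) = 0 := by
    rw [Equiv.symm_apply_eq]
    simp [tensorLeftHomEquiv]
  rw [key]
  apply h
  rw [tensorLeftHomEquiv_symm_naturality, F.map_comp, Functor.Monoidal.map_whiskerLeft, hF]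
  simp

/-- STATEMENT 15: let `F : C ⥤ D` be a monoidal additive functor between additive monoidal
categories, let `I` be a set of objects of `C` such that every object of `C` is a finite
direct sum of objects of `I`, and assume every object of `C` has a right dual. If the map
`Hom(X, 𝟙_C) → Hom(F X, 𝟙_D)`, `φ ↦ F(φ)` composed with the structure isomorphism
`F(𝟙_C) ≅ 𝟙_D`, is injective for every `X ∈ I`, then `F` is faithful. -/
theorem faithful_of_injective_on_hom_to_unit
    {C : Type u₁} [Category.{v₁} C] [MonoidalCategory C]
    [Preadditive C] [MonoidalPreadditive C] [HasFiniteBiproducts C]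
    {D : Type u₂} [Category.{v₂} D] [MonoidalCategory D]
    [Preadditive D] [MonoidalPreadditive D] [HasFiniteBiproducts D]
    [RightRigidCategory C]
    (F : C ⥤ D) [F.Monoidal] [F.Additive]
    (I : Set C)
    (hI : ∀ X : C, ∃ (n : ℕ) (Z : Fin n → C),
      (∀ i, Z i ∈ I) ∧ Nonempty (X ≅ ⨁ Z))
    (hinj : ∀ X ∈ I, Function.Injective
      (fun φ : X ⟶ 𝟙_ C => F.map φ ≫ Functor.OplaxMonoidal.η F)) :
    F.Faithful := by
  refine faithful_of_eq_zero_of_map_eq_zero_to_unit F fun {X} φ hφ => ?_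
  obtain ⟨n, Z, hZ, ⟨e⟩⟩ := hI X
  exact eq_zero_of_map_comp_eq_zero_of_iso_biproduct F _ Z (fun j => hinj _ (hZ j)) e φ hφ
end

section
/- Let C and D be additive monoidal categories and F : C ⥤ D a monoidal additive functor. Let I be a set of objects of C such that every object of C is isomorphic to a finite direct sum of objects of I, and assume that every object of C has a right dual. If for every X ∈ I the map Hom_C(X, 𝟙_C) → Hom_D(F(X), 𝟙_D) induced by F (composed with the structure isomorphism F(𝟙_C) ≅ 𝟙_D) is surjective, then F is a full functor. -/
open CategoryTheory CategoryTheory.Limits MonoidalCategory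

universe v₁ v₂ u₁ u₂

attribute [local instance] CategoryTheory.Limits.hasBinaryBiproducts_of_finite_biproducts

namespace CategoryTheory

section MapExactPairing

variable {C : Type u₁} [Category.{v₁} C] [MonoidalCategory C]
  {D : Type u₂} [Category.{v₂} D] [MonoidalCategory D] (F : C ⥤ D) [F.Monoidal]

open Functor.LaxMonoidal Functor.OplaxMonoidal

/-- A monoidal functor sends exact pairings to exact pairings. -/
@[reducible]
def Functor.Monoidal.mapExactPairing (X Y : C) [ExactPairing X Y] :
    ExactPairing (F.obj X) (F.obj Y) where
  coevaluation' := ε F ≫ F.map (ExactPairing.coevaluation X Y) ≫ δ F X Y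
  evaluation' := μ F Y X ≫ F.map (ExactPairing.evaluation X Y) ≫ η F
  coevaluation_evaluation' := by
    have h := congrArg F.map (ExactPairing.coevaluation_evaluation X Y)
    simp only [Functor.map_comp, Functor.Monoidal.map_associator_inv,
      Functor.Monoidal.map_whiskerLeft, Functor.Monoidal.map_whiskerRight,
      Functor.Monoidal.map_rightUnitor, Functor.Monoidal.map_leftUnitor_inv,
      Category.assoc, Functor.Monoidal.μ_δ_assoc] at h
    rw [← cancel_epi (F.obj Y ◁ η F), ← cancel_epi (δ F Y (𝟙_ C)), ← cancel_mono (ε F ▷ F.obj Y),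
      ← cancel_mono (μ F (𝟙_ C) Y)]
    simpa using h
  evaluation_coevaluation' := by
    have h := congrArg F.map (ExactPairing.evaluation_coevaluation X Y)
    simp only [Functor.map_comp, Functor.Monoidal.map_associator,
      Functor.Monoidal.map_whiskerLeft, Functor.Monoidal.map_whiskerRight,
      Functor.Monoidal.map_leftUnitor, Functor.Monoidal.map_rightUnitor_inv,
      Category.assoc, Functor.Monoidal.μ_δ_assoc] at h
    rw [← cancel_epi (η F ▷ F.obj X), ← cancel_epi (δ F (𝟙_ C) X), ← cancel_mono (F.obj X ◁ ε F),
      ← cancel_mono (μ F X (𝟙_ C))]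
    simpa using h

attribute [local instance] Functor.Monoidal.mapExactPairing

lemma map_tensorLeftHomEquiv_comp_δ (X Y Y' Z : C) [ExactPairing Y Y'] (φ : Y' ⊗ X ⟶ Z) :
    F.map (tensorLeftHomEquiv X Y Y' Z φ) ≫ δ F Y Z =
      tensorLeftHomEquiv (F.obj X) (F.obj Y) (F.obj Y') (F.obj Z) (μ F Y' X ≫ F.map φ) := by
  change F.map ((λ_ X).inv ≫ η_ Y Y' ▷ X ≫ (α_ _ _ _).hom ≫ Y ◁ φ) ≫ δ F Y Z =
    (λ_ _).inv ≫ (ε F ≫ F.map (η_ Y Y') ≫ δ F Y Y') ▷ F.obj X ≫ (α_ _ _ _).hom ≫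
      F.obj Y ◁ (μ F Y' X ≫ F.map φ)
  simp only [Functor.map_comp, Functor.Monoidal.map_associator, Functor.Monoidal.map_whiskerLeft,
    Functor.Monoidal.map_whiskerRight, Functor.Monoidal.map_leftUnitor_inv, Category.assoc]
  simp

end MapExactPairing

lemma map_comp_surjective_of_iso_biproduct {C : Type u₁} [Category.{v₁} C] [Preadditive C]
    {D : Type u₂} [Category.{v₂} D] [Preadditive D] (F : C ⥤ D) [F.Additive]
    {J : Type} [Finite J] {Z : J → C} [HasBiproduct Z] {X : C} (e : X ≅ ⨁ Z) {T : C} {T' : D}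
    (t : F.obj T ⟶ T')
    (h : ∀ j, Function.Surjective (fun φ : Z j ⟶ T => F.map φ ≫ t)) :
    Function.Surjective (fun φ : X ⟶ T => F.map φ ≫ t) := by
  intro g
  choose φ hφ using fun j => h j (F.map (biproduct.ι Z j ≫ e.inv) ≫ g)
  refine ⟨e.hom ≫ biproduct.desc φ, ?_⟩
  have hφ' : F.map (biproduct.desc φ) ≫ t = F.map e.inv ≫ g := by
    rw [← cancel_epi (F.mapBiproduct Z).inv]
    refine biproduct.hom_ext' _ _ fun j => ?_
    have hι : biproduct.ι (F.obj ∘ Z) j ≫ (F.mapBiproduct Z).inv = F.map (biproduct.ι Z j) := by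
      rw [Functor.mapBiproduct_inv]
      exact biproduct.ι_desc _ _
    simp only [← Category.assoc, hι, ← Functor.map_comp, biproduct.ι_desc]
    exact hφ j
  simp [hφ']

end CategoryTheory

/-- STATEMENT 16: let `F : C ⥤ D` be a monoidal additive functor between additive monoidal
categories, let `I` be a set of objects of `C` such that every object of `C` is a finite
direct sum of objects of `I`, and assume every object of `C` has a right dual. If the map
`Hom(X, 𝟙_C) → Hom(F X, 𝟙_D)`, `φ ↦ F(φ)` composed with the structure isomorphism
`F(𝟙_C) ≅ 𝟙_D`, is surjective for every `X ∈ I`, then `F` is full. -/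
theorem full_of_surjective_on_hom_to_unit
    {C : Type u₁} [Category.{v₁} C] [MonoidalCategory C]
    [Preadditive C] [MonoidalPreadditive C] [HasFiniteBiproducts C]
    {D : Type u₂} [Category.{v₂} D] [MonoidalCategory D]
    [Preadditive D] [MonoidalPreadditive D] [HasFiniteBiproducts D]
    [RightRigidCategory C]
    (F : C ⥤ D) [F.Monoidal] [F.Additive]
    (I : Set C)
    (hI : ∀ X : C, ∃ (n : ℕ) (Z : Fin n → C),
      (∀ i, Z i ∈ I) ∧ Nonempty (X ≅ ⨁ Z))
    (hsurj : ∀ X ∈ I, Function.Surjective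
      (fun φ : X ⟶ 𝟙_ C => F.map φ ≫ Functor.OplaxMonoidal.η F)) :
    F.Full := by
  let := Functor.Monoidal.mapExactPairing F
  refine ⟨fun {X Y} g => ?_⟩
  obtain ⟨n, Z, hZ, ⟨e⟩⟩ := hI (Yᘁ ⊗ X)
  obtain ⟨φ, hφ⟩ := map_comp_surjective_of_iso_biproduct F e (Functor.OplaxMonoidal.η F)
    (fun i => hsurj _ (hZ i)) (Functor.OplaxMonoidal.δ F Yᘁ X ≫
      (tensorLeftHomEquiv (F.obj X) (F.obj Y) (F.obj Yᘁ) (𝟙_ D)).symm (g ≫ (ρ_ _).inv))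
  refine ⟨tensorLeftHomEquiv X Y Yᘁ (𝟙_ C) φ ≫ (ρ_ Y).hom, ?_⟩
  dsimp only at hφ
  rw [Functor.map_comp, Functor.Monoidal.map_rightUnitor, ← Category.assoc,
    map_tensorLeftHomEquiv_comp_δ, ← Category.assoc, ← tensorLeftHomEquiv_naturality, Category.assoc, hφ,
    Functor.Monoidal.μ_δ_assoc, Equiv.apply_symm_apply]
  simp
end

section
/- Let C and D be additive monoidal categories and F : C ⥤ D a monoidal additive functor. Let I be a set of objects of C such that every object of C is isomorphic to a finite direct sum of objects of I, and assume that every object of C has a right dual. If F is essentially surjective and for every X ∈ I the map Hom_C(X, 𝟙_C) → Hom_D(F(X), 𝟙_D) induced by F (composed with the structure isomorphism F(𝟙_C) ≅ 𝟙_D) is bijective, then F is an equivalence of categories. -/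
open CategoryTheory CategoryTheory.Limits MonoidalCategory

universe v₁ v₂ u₁ u₂

attribute [local instance] CategoryTheory.Limits.hasBinaryBiproducts_of_finite_biproducts

section

open Functor.LaxMonoidal Functor.OplaxMonoidal

variable {C : Type u₁} [Category.{v₁} C] {D : Type u₂} [Category.{v₂} D]

/-- If `φ ↦ F φ ≫ u` is bijective on morphisms to `S` out of each `Z j`, then it is bijective on
morphisms out of any object isomorphic to the biproduct of the `Z j`. -/
theorem bijective_map_comp_of_iso_biproduct [Preadditive C] [Preadditive D] (F : C ⥤ D)
    [F.Additive] {J : Type} [Fintype J] {Z : J → C} [HasBiproduct Z] {X : C} (e : X ≅ ⨁ Z)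
    {S : C} {T : D} (u : F.obj S ⟶ T)
    (h : ∀ j, Function.Bijective (fun φ : Z j ⟶ S => F.map φ ≫ u)) :
    Function.Bijective (fun φ : X ⟶ S => F.map φ ≫ u) := by
  classical
  constructor
  · intro φ ψ hφψ
    rw [← cancel_epi e.inv]
    refine biproduct.hom_ext' _ _ fun j => (h j).injective ?_
    simpa using congrArg (F.map (biproduct.ι Z j ≫ e.inv) ≫ ·) hφψ
  · intro g
    choose φ hφ using fun j => (h j).surjective (F.map (biproduct.ι Z j ≫ e.inv) ≫ g)
    refine ⟨e.hom ≫ biproduct.desc φ, ?_⟩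
    have hsum : e.hom ≫ (∑ j, biproduct.π Z j ≫ biproduct.ι Z j) ≫ e.inv = 𝟙 X := by
      rw [biproduct.total, Category.id_comp, e.hom_inv_id]
    have hg : g = F.map (e.hom ≫ (∑ j, biproduct.π Z j ≫ biproduct.ι Z j) ≫ e.inv) ≫ g := by
      rw [hsum, F.map_id, Category.id_comp]
    rw [hg]
    simp only [biproduct.desc_eq, Functor.map_comp, Functor.map_sum, Category.assoc,
      Preadditive.sum_comp, Preadditive.comp_sum] at hφ ⊢
    exact Finset.sum_congr rfl fun j _ => by rw [hφ j]

variable [MonoidalCategory C] [MonoidalCategory D]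

/-- A monoidal functor maps exact pairings to exact pairings. -/
abbrev exactPairingMap (F : C ⥤ D) [F.Monoidal] (X Y : C) [ExactPairing X Y] :
    ExactPairing (F.obj X) (F.obj Y) where
  coevaluation' := ε F ≫ F.map (η_ X Y) ≫ δ F X Y
  evaluation' := μ F Y X ≫ F.map (ε_ X Y) ≫ η F
  coevaluation_evaluation' := by
    have h := congrArg F.map (ExactPairing.coevaluation_evaluation X Y)
    simp only [Functor.map_comp, Functor.Monoidal.map_whiskerLeft,
      Functor.Monoidal.map_whiskerRight, Functor.Monoidal.map_associator_inv,
      Functor.Monoidal.map_rightUnitor, Functor.Monoidal.map_leftUnitor_inv] at h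
    have h' := congrArg (F.obj Y ◁ ε F ≫ μ F _ _ ≫ · ≫ δ F _ _ ≫ η F ▷ F.obj Y) h
    simpa only [Category.assoc, Functor.Monoidal.μ_δ_assoc, Functor.Monoidal.μ_δ,
      Functor.Monoidal.whiskerLeft_ε_η_assoc, Functor.Monoidal.whiskerRight_ε_η,
      MonoidalCategory.whiskerLeft_comp, comp_whiskerRight, Category.comp_id] using h'
  evaluation_coevaluation' := by
    have h := congrArg F.map (ExactPairing.evaluation_coevaluation X Y)
    simp only [Functor.map_comp, Functor.Monoidal.map_whiskerLeft,
      Functor.Monoidal.map_whiskerRight, Functor.Monoidal.map_associator,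
      Functor.Monoidal.map_leftUnitor, Functor.Monoidal.map_rightUnitor_inv] at h
    have h' := congrArg (ε F ▷ F.obj X ≫ μ F _ _ ≫ · ≫ δ F _ _ ≫ F.obj X ◁ η F) h
    simpa only [Category.assoc, Functor.Monoidal.μ_δ_assoc, Functor.Monoidal.μ_δ,
      Functor.Monoidal.whiskerRight_ε_η_assoc, Functor.Monoidal.whiskerLeft_ε_η,
      MonoidalCategory.whiskerLeft_comp, comp_whiskerRight, Category.comp_id] using h'

/-- Morphisms `X ⟶ Y` correspond to morphisms `Y' ⊗ X ⟶ 𝟙_ C` by pairing with a right dual `Y'`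
of `Y`. -/
theorem bijective_whiskerLeft_comp_evaluation (X Y Y' : C) [ExactPairing Y Y'] :
    Function.Bijective (fun f : X ⟶ Y => Y' ◁ f ≫ ε_ Y Y') := by
  convert! (((Iso.refl X).homCongr (ρ_ Y).symm).trans
    (tensorLeftHomEquiv X Y Y' (𝟙_ C)).symm).bijective using 2 with f
  simp only [Equiv.trans_apply, Iso.homCongr_apply, Iso.refl_inv, Iso.symm_hom, Category.id_comp,
    tensorLeftHomEquiv, Equiv.coe_fn_symm_mk, MonoidalCategory.whiskerLeft_comp]
  monoidal

/-- A monoidal functor is bijective on `X ⟶ Y` if it is bijective on the morphisms to the unit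
out of `Y' ⊗ X`, where `Y'` is a right dual of `Y`. -/
theorem map_bijective_of_bijective_map_comp_η (F : C ⥤ D) [F.Monoidal] (X Y Y' : C)
    [ExactPairing Y Y']
    (h : Function.Bijective (fun φ : Y' ⊗ X ⟶ 𝟙_ C => F.map φ ≫ η F)) :
    Function.Bijective (F.map : (X ⟶ Y) → (F.obj X ⟶ F.obj Y)) := by
  let := exactPairingMap F Y Y'
  rw [← (bijective_whiskerLeft_comp_evaluation (F.obj X) (F.obj Y) (F.obj Y')).of_comp_iff']
  have hcomp : (fun f : F.obj X ⟶ F.obj Y => F.obj Y' ◁ f ≫ ε_ (F.obj Y) (F.obj Y')) ∘ F.map =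
      (Functor.Monoidal.μIso F Y' X).symm.homCongr (Iso.refl (𝟙_ D)) ∘
        (fun φ : Y' ⊗ X ⟶ 𝟙_ C => F.map φ ≫ η F) ∘ fun f : X ⟶ Y => Y' ◁ f ≫ ε_ Y Y' := by
    funext f
    change F.obj Y' ◁ F.map f ≫ μ F Y' Y ≫ F.map (ε_ Y Y') ≫ η F = _
    simp
  rw [hcomp]
  exact (Iso.homCongr _ _).bijective.comp
    (h.comp (bijective_whiskerLeft_comp_evaluation X Y Y'))

end

/-- STATEMENT 17: let `F : C ⥤ D` be a monoidal additive functor between additive monoidal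
categories, let `I` be a set of objects of `C` such that every object of `C` is a finite
direct sum of objects of `I`, and assume every object of `C` has a right dual. If `F` is
essentially surjective and the map `Hom(X, 𝟙_C) → Hom(F X, 𝟙_D)`, `φ ↦ F(φ)` composed with
the structure isomorphism `F(𝟙_C) ≅ 𝟙_D`, is bijective for every `X ∈ I`, then `F` is an
equivalence of categories. -/
theorem equivalence_of_bijective_on_hom_to_unit
    {C : Type u₁} [Category.{v₁} C] [MonoidalCategory C]
    [Preadditive C] [MonoidalPreadditive C] [HasFiniteBiproducts C]
    {D : Type u₂} [Category.{v₂} D] [MonoidalCategory D]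
    [Preadditive D] [MonoidalPreadditive D] [HasFiniteBiproducts D]
    [RightRigidCategory C]
    (F : C ⥤ D) [F.Monoidal] [F.Additive] [F.EssSurj]
    (I : Set C)
    (hI : ∀ X : C, ∃ (n : ℕ) (Z : Fin n → C),
      (∀ i, Z i ∈ I) ∧ Nonempty (X ≅ ⨁ Z))
    (hbij : ∀ X ∈ I, Function.Bijective
      (fun φ : X ⟶ 𝟙_ C => F.map φ ≫ Functor.OplaxMonoidal.η F)) :
    F.IsEquivalence := by
  have hη (X : C) : Function.Bijective
      (fun φ : X ⟶ 𝟙_ C => F.map φ ≫ Functor.OplaxMonoidal.η F) := by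
    obtain ⟨n, Z, hZ, ⟨e⟩⟩ := hI X
    exact bijective_map_comp_of_iso_biproduct F e _ fun i => hbij _ (hZ i)
  have hmap (X Y : C) := map_bijective_of_bijective_map_comp_η F X Y Yᘁ (hη _)
  have : F.Faithful := ⟨fun h => (hmap _ _).injective h⟩
  have : F.Full := ⟨(hmap _ _).surjective⟩
  exact {}
end
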